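/- There is a universal constant C > 0 such that the following holds. Let G=(V,E) be a finite connected d-regular graph on n vertices with relaxation time t_rel, let x be any vertex, let K ≥ 1, and let I_t^{(1)},…,I_t^{(K)} be independent copies of the number of intersections I_t of two independent lazy random walks of length t started at x. Define the estimator n̂_t = t² / ((1/K)·Σ_{k=1}^K I_t^{(k)}). Then for every t ≥ 2√6·t_rel^{3/4}·√n, P_x(|n̂_t/n − 1| > 1/2) ≤ C/K. -/

import Mathlib

open Finset
open scoped Classical BigOperators

/-- The transition matrix of the lazy random walk on a finite graph `G`. -/
noncomputable def lazyP {V : Type} [Fintype V] (G : SimpleGraph V) : Matrix V V ℝ :=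
  fun u v =>
    if u = v then 1 / 2
    else if G.Adj u v then 1 / (2 * (G.degree u : ℝ)) else 0

/-- The number of edges of `G`. -/
noncomputable def numEdges {V : Type} [Fintype V] (G : SimpleGraph V) : ℕ :=
  G.edgeFinset.card

/-- The stationary distribution `π(u) = deg(u) / (2m)` of the lazy random walk. -/
noncomputable def statDist {V : Type} [Fintype V] (G : SimpleGraph V) (u : V) : ℝ :=
  (G.degree u : ℝ) / (2 * (numEdges G : ℝ))

/-- The second-largest eigenvalue `λ₂` of a reversible transition matrix: the supremum of
the (real) eigenvalues different from `1`. -/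
noncomputable def secondEig {V : Type} [Fintype V] (P : Matrix V V ℝ) : ℝ :=
  sSup {r : ℝ | r ≠ 1 ∧ ∃ f : V → ℝ, f ≠ 0 ∧ P.mulVec f = r • f}

/-- The relaxation time `t_rel = ⌈1 / (1 - λ₂)⌉`. -/
noncomputable def relTime {V : Type} [Fintype V] (P : Matrix V V ℝ) : ℕ :=
  ⌈1 / (1 - secondEig P)⌉₊

/-- The uniform mixing time of the lazy random walk on `G`. -/
noncomputable def unifTime {V : Type} [Fintype V] (G : SimpleGraph V) : ℕ :=
  sInf {t : ℕ | ∀ x y : V, |(lazyP G ^ t) x y / statDist G y - 1| ≤ 1 / 4}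

/-- The Green's function `g_t(x, u) = ∑_{i<t} P^i(x, u)`. -/
noncomputable def green {V : Type} [Fintype V] (P : Matrix V V ℝ) (t : ℕ) (x u : V) : ℝ :=
  ∑ i ∈ Finset.range t, (P ^ i) x u

/-- The value of a finite trajectory at a natural number index (junk beyond the horizon). -/
noncomputable def traj {V : Type} [Nonempty V] {t : ℕ} (p : Fin t → V) (i : ℕ) : V :=
  if h : i < t then p ⟨i, h⟩ else Classical.arbitrary V

/-- The probability that the chain `P` started at `x` follows the length-`t` trajectory `p`. -/
noncomputable def pathWeight {V : Type} [Fintype V] [Nonempty V] (P : Matrix V V ℝ)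
    (x : V) (t : ℕ) (p : Fin t → V) : ℝ :=
  (if traj p 0 = x then 1 else 0) *
    ∏ i ∈ Finset.range (t - 1), P (traj p i) (traj p (i + 1))

/-- Expectation of a functional of two independent length-`t` walks started at `x` and `y`. -/
noncomputable def E2 {V : Type} [Fintype V] [Nonempty V] (P : Matrix V V ℝ) (x y : V)
    (t : ℕ) (F : (Fin t → V) → (Fin t → V) → ℝ) : ℝ :=
  ∑ p : Fin t → V, ∑ q : Fin t → V, pathWeight P x t p * pathWeight P y t q * F p q

/-- Expectation of a functional of three independent length-`t` walks started at `x`. -/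
noncomputable def E3 {V : Type} [Fintype V] [Nonempty V] (P : Matrix V V ℝ) (x : V)
    (t : ℕ) (F : (Fin t → V) → (Fin t → V) → (Fin t → V) → ℝ) : ℝ :=
  ∑ p : Fin t → V, ∑ q : Fin t → V, ∑ r : Fin t → V,
    pathWeight P x t p * pathWeight P x t q * pathWeight P x t r * F p q r

/-- Expectation of a functional of `2K` independent length-`t` walks
(`K` pairs) started at `x`. -/
noncomputable def EK {V : Type} [Fintype V] [Nonempty V] (P : Matrix V V ℝ) (x : V)
    (t K : ℕ) (F : (Fin K → Fin t → V) → (Fin K → Fin t → V) → ℝ) : ℝ :=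
  ∑ X : Fin K → Fin t → V, ∑ Y : Fin K → Fin t → V,
    (∏ k, pathWeight P x t (X k)) * (∏ k, pathWeight P x t (Y k)) * F X Y

/-- Expectation of a functional of `K` independent length-`t` walks started at `x`. -/
noncomputable def EKone {V : Type} [Fintype V] [Nonempty V] (P : Matrix V V ℝ) (x : V)
    (t K : ℕ) (F : (Fin K → Fin t → V) → ℝ) : ℝ :=
  ∑ X : Fin K → Fin t → V, (∏ k, pathWeight P x t (X k)) * F X

/-- The weighted number of intersections of two trajectories over the time window `[a, b)`:
`∑_{i,j=a}^{b-1} (1 / deg(p_i)) 1{p_i = q_j}`. -/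
noncomputable def wInterIco {V : Type} [Fintype V] [Nonempty V] (G : SimpleGraph V)
    (a b : ℕ) {t : ℕ} (p q : Fin t → V) : ℝ :=
  ∑ i ∈ Finset.Ico a b, ∑ j ∈ Finset.Ico a b,
    if traj p i = traj q j then 1 / (G.degree (traj p i) : ℝ) else 0

/-- The weighted number of intersections `𝓘_t` of two trajectories, up to time `t - 1`. -/
noncomputable def wInter {V : Type} [Fintype V] [Nonempty V] (G : SimpleGraph V)
    {t : ℕ} (p q : Fin t → V) : ℝ :=
  wInterIco G 0 t p q

/-- The (unweighted) number of intersections `I_t` of two trajectories, up to time `t - 1`. -/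
noncomputable def nInter {V : Type} [Nonempty V] {t : ℕ} (p q : Fin t → V) : ℝ :=
  ∑ i ∈ Finset.range t, ∑ j ∈ Finset.range t,
    if traj p i = traj q j then (1 : ℝ) else 0

/-- `E_{x,y}[𝓘_t]`: expected weighted number of intersections of two independent lazy random
walks started at `x` and `y`. -/
noncomputable def EIxy {V : Type} [Fintype V] [Nonempty V] (G : SimpleGraph V)
    (x y : V) (t : ℕ) : ℝ :=
  E2 (lazyP G) x y t fun p q => wInter G p q

/-- `E_x[𝓘_t]`. -/
noncomputable def EI {V : Type} [Fintype V] [Nonempty V] (G : SimpleGraph V)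
    (x : V) (t : ℕ) : ℝ :=
  EIxy G x x t

/-- `E_x[𝓘_t²]`. -/
noncomputable def EIsq {V : Type} [Fintype V] [Nonempty V] (G : SimpleGraph V)
    (x : V) (t : ℕ) : ℝ :=
  E2 (lazyP G) x x t fun p q => (wInter G p q) ^ 2

/-- `E_x[𝓙_t]`: expected weighted number of intersections over the window
`[t_unif, t_unif + t - 1]`. -/
noncomputable def EJ {V : Type} [Fintype V] [Nonempty V] (G : SimpleGraph V)
    (x : V) (t : ℕ) : ℝ :=
  E2 (lazyP G) x x (unifTime G + t) fun p q =>
    wInterIco G (unifTime G) (unifTime G + t) p q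

/-- `E_x[𝓙_t²]`. -/
noncomputable def EJsq {V : Type} [Fintype V] [Nonempty V] (G : SimpleGraph V)
    (x : V) (t : ℕ) : ℝ :=
  E2 (lazyP G) x x (unifTime G + t) fun p q =>
    (wInterIco G (unifTime G) (unifTime G + t) p q) ^ 2

/-- `E_x[ℒ_t]`: expected weighted number of intersections between times `t` and `2t - 1`. -/
noncomputable def EL {V : Type} [Fintype V] [Nonempty V] (G : SimpleGraph V)
    (x : V) (t : ℕ) : ℝ :=
  E2 (lazyP G) x x (2 * t) fun p q => wInterIco G t (2 * t) p q

/-- `E_x[ℒ_t²]`. -/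
noncomputable def ELsq {V : Type} [Fintype V] [Nonempty V] (G : SimpleGraph V)
    (x : V) (t : ℕ) : ℝ :=
  E2 (lazyP G) x x (2 * t) fun p q => (wInterIco G t (2 * t) p q) ^ 2

/-- `E_x[ℒ_t^{(X,Y)} · ℒ_t^{(X,Z)}]` for three independent walks `X, Y, Z` started at `x`. -/
noncomputable def ELprod {V : Type} [Fintype V] [Nonempty V] (G : SimpleGraph V)
    (x : V) (t : ℕ) : ℝ :=
  E3 (lazyP G) x (2 * t) fun p q r =>
    wInterIco G t (2 * t) p q * wInterIco G t (2 * t) p r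

/-- The inner product `⟨f, g⟩_π = ∑_x π(x) f(x) g(x)`. -/
noncomputable def ipi {X : Type} [Fintype X] (π : X → ℝ) (f g : X → ℝ) : ℝ :=
  ∑ x, π x * f x * g x

/-- The position of the first occurrence of `s i` in the finite sequence `s`. -/
noncomputable def firstOcc {V : Type} {N : ℕ} (s : Fin N → V) (i : Fin N) : ℕ :=
  sInf {j : ℕ | ∃ h : j < N, s ⟨j, h⟩ = s i}

/-- The index (rank) of first occurrence of `s i` among the distinct values of `s`,
in order of first appearance. -/
noncomputable def rankSeq {V : Type} {N : ℕ} (s : Fin N → V) (i : Fin N) : ℕ :=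
  ((Finset.univ.image fun j : Fin N => firstOcc s j).filter
    fun a => a ≤ firstOcc s i).card

/-- The profile `Φ` of a finite sequence of vertices: the sequence of ranks of first
occurrence together with the sequence of degrees. -/
noncomputable def profileOf {V : Type} [Fintype V] (G : SimpleGraph V) {N : ℕ}
    (s : Fin N → V) : Fin N → ℕ × ℕ :=
  fun i => (rankSeq s i, G.degree (s i))

/-- Concatenation of `K` trajectories of length `t` into one sequence of length `K * t`. -/
noncomputable def concatW {V : Type} [Nonempty V] {K t : ℕ} (X : Fin K → Fin t → V)
    (i : Fin (K * t)) : V :=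
  if h : 0 < t then
    X ⟨i.1 / t, (Nat.div_lt_iff_lt_mul h).2 i.2⟩ ⟨i.1 % t, Nat.mod_lt _ h⟩
  else Classical.arbitrary V

/-- Expectation along one walk. -/
noncomputable def Ew {V : Type} [Fintype V] [Nonempty V] (P : Matrix V V ℝ) (x : V)
    (t : ℕ) (F : (Fin t → V) → ℝ) : ℝ := ∑ p : Fin t → V, pathWeight P x t p * F p

lemma traj_cons_zero {V : Type} [Nonempty V] {t : ℕ} (y : V) (p : Fin t → V) :
    traj (Fin.cons y p : Fin (t+1) → V) 0 = y := by
  simp [traj]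

lemma traj_cons_succ {V : Type} [Nonempty V] {t : ℕ} (y : V) (p : Fin t → V) (i : ℕ) :
    traj (Fin.cons y p : Fin (t+1) → V) (i+1) = traj p i := by
  unfold traj
  by_cases h : i < t
  · have h' : i + 1 < t + 1 := by omega
    simp only [h, h', dif_pos]
    exact Fin.cons_succ (α := fun _ => V) y p ⟨i, h⟩
  · have h' : ¬ i + 1 < t + 1 := by omega
    simp only [h, h', dif_neg, not_false_iff]

lemma pathWeight_cons {V : Type} [Fintype V] [Nonempty V] (P : Matrix V V ℝ) (x y : V) (t : ℕ)
    (p : Fin (t+1) → V) :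
    pathWeight P x (t+2) (Fin.cons y p : Fin (t+2) → V) =
      (if y = x then 1 else 0) * ∑ z, P x z * pathWeight P z (t+1) p := by
  unfold pathWeight
  rw [traj_cons_zero]
  by_cases h : y = x
  · subst h
    simp only [if_true, one_mul]
    have : t + 2 - 1 = t + 1 := by omega
    rw [this, Finset.prod_range_succ']
    simp only [traj_cons_succ, traj_cons_zero, zero_add]
    have h0 := traj_cons_succ y p 0
    simp only [zero_add] at h0
    rw [Finset.sum_eq_single (traj p 0)]
    · simp; ring
    · intro b _ hb
      simp [hb.symm]
    · simp
  · simp [h]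

lemma Ew_succ {V : Type} [Fintype V] [Nonempty V] (P : Matrix V V ℝ) (x : V) (t : ℕ)
    (F : (Fin (t+2) → V) → ℝ) :
    Ew P x (t+2) F = ∑ z, P x z * Ew P z (t+1) (fun p => F (Fin.cons x p)) := by
  unfold Ew
  have h : ∑ p : Fin (t+2) → V, pathWeight P x (t+2) p * F p =
      ∑ y : V, ∑ p : Fin (t+1) → V,
        pathWeight P x (t+2) (Fin.cons y p : Fin (t+2) → V) * F (Fin.cons y p) := by
    rw [← (Fin.consEquiv (fun _ : Fin (t+2) => V)).sum_comp, Fintype.sum_prod_type]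
    rfl
  rw [h]
  simp only [pathWeight_cons]
  rw [Finset.sum_eq_single x]
  · simp only [if_true, one_mul, Finset.sum_mul, Finset.mul_sum]
    rw [Finset.sum_comm]
    simp only [mul_assoc]
  · intro b _ hb
    simp [hb]
  · simp

lemma Ew_one {V : Type} [Fintype V] [Nonempty V] (P : Matrix V V ℝ) (x : V)
    (F : (Fin 1 → V) → ℝ) : Ew P x 1 F = F (fun _ => x) := by
  unfold Ew
  rw [Finset.sum_eq_single (fun _ => x)]
  · simp [pathWeight, traj]
  · intro b _ hb
    have : b 0 ≠ x := fun h => hb (by funext i; rw [Subsingleton.elim i 0, h])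
    simp [pathWeight, traj, this]
  · simp

lemma Ew_total {V : Type} [Fintype V] [Nonempty V] (P : Matrix V V ℝ) (hs : ∀ u, ∑ v, P u v = 1)
    (t : ℕ) : ∀ x : V, Ew P x (t+1) (fun _ => 1) = 1 := by
  induction t with
  | zero => intro x; rw [Ew_one]
  | succ t ih => intro x; rw [Ew_succ]; simp [ih, hs]

lemma Ew_marg {V : Type} [Fintype V] [Nonempty V] (P : Matrix V V ℝ) (hs : ∀ u, ∑ v, P u v = 1)
    (u : V) (t : ℕ) : ∀ (x : V) (i : ℕ), i < t + 1 →
      Ew P x (t+1) (fun p => if traj p i = u then 1 else 0) = (P ^ i) x u := by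
  induction t with
  | zero =>
    intro x i hi
    obtain rfl : i = 0 := by omega
    rw [Ew_one]; simp [traj, Matrix.one_apply]
  | succ t ih =>
    intro x i hi
    rw [Ew_succ]
    cases i with
    | zero =>
      simp only [traj_cons_zero, pow_zero, Matrix.one_apply]
      have : ∀ z, Ew P z (t+1) (fun _ => if x = u then (1:ℝ) else 0) = if x = u then 1 else 0 := by
        intro z
        split_ifs
        · exact Ew_total P hs t z
        · simp [Ew]
      simp only [this, ← Finset.sum_mul, hs, one_mul]
    | succ i =>
      simp only [traj_cons_succ]
      rw [pow_succ', Matrix.mul_apply]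
      refine Finset.sum_congr rfl fun z _ => ?_
      rw [ih z i (by omega)]

lemma Ew_marg2 {V : Type} [Fintype V] [Nonempty V] (P : Matrix V V ℝ) (hs : ∀ u, ∑ v, P u v = 1)
    (u v : V) (t : ℕ) : ∀ (x : V) (i k : ℕ), i ≤ k → k < t + 1 →
      Ew P x (t+1) (fun p => (if traj p i = u then 1 else 0) * (if traj p k = v then 1 else 0))
        = (P ^ i) x u * (P ^ (k - i)) u v := by
  have h0 : ∀ (t : ℕ) (x : V) (k : ℕ), k < t + 1 →
      Ew P x (t+1) (fun p => (if traj p 0 = u then 1 else 0) * (if traj p k = v then 1 else 0))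
        = (P ^ 0) x u * (P ^ k) u v := by
    intro t x k hk
    have : Ew P x (t+1) (fun p => (if traj p 0 = u then 1 else 0) * (if traj p k = v then 1 else 0))
        = (if x = u then 1 else 0) *
          Ew P x (t+1) (fun p => (if traj p k = v then 1 else 0)) := by
      unfold Ew
      rw [Finset.mul_sum]
      refine Finset.sum_congr rfl fun p _ => ?_
      unfold pathWeight
      by_cases h : traj p 0 = x
      · subst h; simp only [if_true]; ring
      · simp [h]
    rw [this, Ew_marg P hs v t x k hk, pow_zero, Matrix.one_apply]
    by_cases h : x = u
    · subst h; rfl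
    · simp [h]
  induction t with
  | zero =>
    intro x i k hik hk
    obtain rfl : i = 0 := by omega
    exact h0 0 x k hk
  | succ t ih =>
    intro x i k hik hk
    cases i with
    | zero => exact h0 _ x k hk
    | succ i =>
      obtain ⟨k, rfl⟩ : ∃ k', k = k' + 1 := ⟨k - 1, by omega⟩
      rw [Ew_succ]
      simp only [traj_cons_succ]
      rw [pow_succ', Matrix.mul_apply, Finset.sum_mul]
      refine Finset.sum_congr rfl fun z _ => ?_
      rw [ih z i k (by omega) (by omega)]
      have : k + 1 - (i + 1) = k - i := by omega
      rw [this, mul_assoc]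

lemma pathWeight_nonneg {V : Type} [Fintype V] [Nonempty V] (P : Matrix V V ℝ)
    (hp : ∀ u v, 0 ≤ P u v) (x : V) (t : ℕ) (p : Fin t → V) : 0 ≤ pathWeight P x t p := by
  unfold pathWeight
  refine mul_nonneg (by split_ifs <;> norm_num) (Finset.prod_nonneg fun i _ => hp _ _)

/-- Number of visits to u. -/
noncomputable def visits {V : Type} [Nonempty V] {t : ℕ} (p : Fin t → V) (u : V) : ℝ :=
  ∑ i ∈ Finset.range t, if traj p i = u then (1:ℝ) else 0

lemma nInter_eq {V : Type} [Fintype V] [Nonempty V] {t : ℕ} (p q : Fin t → V) :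
    nInter p q = ∑ u, visits p u * visits q u := by
  unfold nInter visits
  simp only [Finset.sum_mul_sum]
  rw [Finset.sum_comm]
  rw [Finset.sum_comm (s := Finset.univ)]
  rw [Finset.sum_comm]
  refine Finset.sum_congr rfl fun i _ => ?_
  rw [Finset.sum_comm (s := Finset.univ)]
  refine Finset.sum_congr rfl fun j _ => ?_
  rw [Finset.sum_eq_single (traj p i)]
  · simp [eq_comm]
  · intro b _ hb
    simp [hb.symm]
  · simp

lemma Ew_sum {V ι : Type} [Fintype V] [Nonempty V] (P : Matrix V V ℝ) (x : V) (t : ℕ)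
    (s : Finset ι) (F : ι → (Fin t → V) → ℝ) :
    Ew P x t (fun p => ∑ i ∈ s, F i p) = ∑ i ∈ s, Ew P x t (F i) := by
  unfold Ew
  simp only [Finset.mul_sum]
  rw [Finset.sum_comm]

lemma Ew_visits {V : Type} [Fintype V] [Nonempty V] (P : Matrix V V ℝ) (hs : ∀ u, ∑ v, P u v = 1)
    (x u : V) (t : ℕ) : Ew P x (t+1) (fun p => visits p u) = green P (t+1) x u := by
  unfold visits green
  rw [Ew_sum]
  exact Finset.sum_congr rfl fun i hi => Ew_marg P hs u t x i (Finset.mem_range.1 hi)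

lemma pow_nonneg_entry {V : Type} [Fintype V] (P : Matrix V V ℝ)
    (hp : ∀ u v, 0 ≤ P u v) (k : ℕ) : ∀ u v, 0 ≤ (P ^ k) u v := by
  induction k with
  | zero => intro u v; rw [pow_zero, Matrix.one_apply]; split_ifs <;> norm_num
  | succ k ih =>
    intro u v
    rw [pow_succ, Matrix.mul_apply]
    exact Finset.sum_nonneg fun z _ => mul_nonneg (ih _ _) (hp _ _)

lemma green_nonneg {V : Type} [Fintype V] (P : Matrix V V ℝ)
    (hp : ∀ u v, 0 ≤ P u v) (t : ℕ) (x u : V) : 0 ≤ green P t x u :=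
  Finset.sum_nonneg fun i _ => pow_nonneg_entry P hp i x u

lemma tri_le {a b : ℕ → ℝ} (hb : ∀ i, 0 ≤ b i) (ha : ∀ i, 0 ≤ a i) (t : ℕ) :
    ∑ i ∈ Finset.range t, ∑ k ∈ Finset.range t, (if i ≤ k then a i * b (k - i) else 0)
      ≤ (∑ i ∈ Finset.range t, a i) * ∑ k ∈ Finset.range t, b k := by
  rw [Finset.sum_mul]
  refine Finset.sum_le_sum fun i _ => ?_
  rw [← Finset.sum_filter, ← Finset.mul_sum]
  refine mul_le_mul_of_nonneg_left ?_ (ha i)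
  rw [← Finset.sum_image (f := b) (g := fun k => k - i)]
  · refine Finset.sum_le_sum_of_subset_of_nonneg ?_ fun j _ _ => hb j
    intro j hj
    simp only [Finset.mem_image, Finset.mem_filter, Finset.mem_range] at hj ⊢
    omega
  · intro k hk l hl h
    simp at hk hl h
    omega

lemma Ew_visits2 {V : Type} [Fintype V] [Nonempty V] (P : Matrix V V ℝ) (hs : ∀ u, ∑ v, P u v = 1)
    (hp : ∀ u v, 0 ≤ P u v) (x u v : V) (t : ℕ) :
    Ew P x (t+1) (fun p => visits p u * visits p v) ≤
      green P (t+1) x u * green P (t+1) u v + green P (t+1) x v * green P (t+1) v u := by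
  have h1 : Ew P x (t+1) (fun p => visits p u * visits p v) =
      ∑ i ∈ Finset.range (t+1), ∑ k ∈ Finset.range (t+1),
        Ew P x (t+1) (fun p => (if traj p i = u then 1 else 0) * (if traj p k = v then 1 else 0)) := by
    unfold visits
    simp only [Finset.sum_mul_sum, Ew_sum]
  rw [h1]
  have h2 := tri_le (a := fun i => (P^i) x u) (b := fun i => (P^i) u v)
    (fun i => pow_nonneg_entry P hp i _ _) (fun i => pow_nonneg_entry P hp i _ _) (t+1)
  have h3 := tri_le (a := fun i => (P^i) x v) (b := fun i => (P^i) v u)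
    (fun i => pow_nonneg_entry P hp i _ _) (fun i => pow_nonneg_entry P hp i _ _) (t+1)
  refine le_trans ?_ (add_le_add h2 h3)
  rw [Finset.sum_comm (f := fun i k => if i ≤ k then (P^i) x v * (P^(k-i)) v u else 0),
    ← Finset.sum_add_distrib]
  refine Finset.sum_le_sum fun i hi => ?_
  rw [← Finset.sum_add_distrib]
  refine Finset.sum_le_sum fun k hk => ?_
  have hi := Finset.mem_range.1 hi
  have hk := Finset.mem_range.1 hk
  rcases le_total i k with h | h
  · rw [Ew_marg2 P hs u v t x i k h hk, if_pos h]
    refine le_add_of_nonneg_right ?_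
    split_ifs
    · exact mul_nonneg (pow_nonneg_entry P hp _ _ _) (pow_nonneg_entry P hp _ _ _)
    · exact le_rfl
  · have : (fun p : Fin (t+1) → V => (if traj p i = u then (1:ℝ) else 0) * (if traj p k = v then 1 else 0))
      = fun p => (if traj p k = v then (1:ℝ) else 0) * (if traj p i = u then 1 else 0) := by
      funext p; ring
    rw [this, Ew_marg2 P hs v u t x k i h hi, if_pos h]
    refine le_add_of_nonneg_left ?_
    split_ifs
    · exact mul_nonneg (pow_nonneg_entry P hp _ _ _) (pow_nonneg_entry P hp _ _ _)
    · exact le_rfl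

lemma E2_prod_sum {V ι : Type} [Fintype V] [Nonempty V] (P : Matrix V V ℝ) (x : V) (t : ℕ)
    (s : Finset ι) (F : ι → (Fin t → V) → ℝ) :
    E2 P x x t (fun p q => ∑ i ∈ s, F i p * F i q) = ∑ i ∈ s, (Ew P x t (F i)) ^ 2 := by
  have h1 : ∀ i ∈ s, (Ew P x t (F i)) ^ 2 = ∑ p, ∑ q,
      pathWeight P x t p * pathWeight P x t q * (F i p * F i q) := by
    intro i _
    unfold Ew
    rw [sq, Finset.sum_mul_sum]
    exact Finset.sum_congr rfl fun p _ => Finset.sum_congr rfl fun q _ => by ring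
  rw [Finset.sum_congr rfl h1]
  unfold E2
  simp only [Finset.mul_sum]
  rw [Finset.sum_comm]
  simp only [Finset.sum_comm (t := s)]
  refine Finset.sum_congr rfl fun i _ => ?_
  rw [Finset.sum_comm]

lemma E2_nInter {V : Type} [Fintype V] [Nonempty V] (P : Matrix V V ℝ) (hs : ∀ u, ∑ v, P u v = 1)
    (x : V) (t : ℕ) :
    E2 P x x (t+1) (fun p q => nInter p q) = ∑ u, (green P (t+1) x u) ^ 2 := by
  simp only [nInter_eq]
  rw [E2_prod_sum P x (t+1) Finset.univ (fun u p => visits p u)]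
  simp only [Ew_visits P hs]

lemma visits_nonneg {V : Type} [Nonempty V] {t : ℕ} (p : Fin t → V) (u : V) : 0 ≤ visits p u :=
  Finset.sum_nonneg fun i _ => by split_ifs <;> norm_num

lemma E2_nInter_sq {V : Type} [Fintype V] [Nonempty V] (P : Matrix V V ℝ)
    (hs : ∀ u, ∑ v, P u v = 1) (hp : ∀ u v, 0 ≤ P u v)
    (x : V) (t : ℕ) (B : ℝ)
    (hB : ∀ u, ∑ v, (green P (t+1) u v) ^ 2 ≤ B) :
    E2 P x x (t+1) (fun p q => (nInter p q)^2) ≤ 4 * B ^ 2 := by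
  have h1 : ∀ p q : Fin (t+1) → V, (nInter p q)^2 =
      ∑ w : V × V, (visits p w.1 * visits p w.2) * (visits q w.1 * visits q w.2) := by
    intro p q
    rw [nInter_eq, sq, Finset.sum_mul_sum, Fintype.sum_prod_type]
    refine Finset.sum_congr rfl fun i _ => ?_
    refine Finset.sum_congr rfl fun j _ => ?_
    ring
  simp only [h1]
  rw [E2_prod_sum P x (t+1) Finset.univ (fun (w : V × V) p => visits p w.1 * visits p w.2),
    Fintype.sum_prod_type]
  have hB0 : 0 ≤ B := le_trans (Finset.sum_nonneg fun v _ => sq_nonneg _) (hB x)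
  have h2 : ∀ u v, (Ew P x (t+1) (fun p => visits p u * visits p v)) ^ 2 ≤
      2 * (green P (t+1) x u)^2 * (green P (t+1) u v)^2 +
      2 * (green P (t+1) x v)^2 * (green P (t+1) v u)^2 := by
    intro u v
    have h3 := Ew_visits2 P hs hp x u v t
    have h4 : 0 ≤ Ew P x (t+1) (fun p => visits p u * visits p v) :=
      Finset.sum_nonneg fun p _ => mul_nonneg (pathWeight_nonneg P hp _ _ _)
        (mul_nonneg (visits_nonneg _ _) (visits_nonneg _ _))
    have h5 := pow_le_pow_left₀ h4 h3 2
    nlinarith [sq_nonneg (green P (t+1) x u * green P (t+1) u v - green P (t+1) x v * green P (t+1) v u)]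
  have h6 : ∑ u, ∑ v, 2 * (green P (t+1) x u)^2 * (green P (t+1) u v)^2 ≤ 2 * B^2 := by
    simp only [← Finset.mul_sum]
    calc _ ≤ ∑ u, 2 * (green P (t+1) x u)^2 * B :=
          Finset.sum_le_sum fun u _ => mul_le_mul_of_nonneg_left (hB u) (by positivity)
      _ = 2 * (∑ u, (green P (t+1) x u)^2) * B := by rw [Finset.mul_sum, Finset.sum_mul]
      _ ≤ 2 * B * B := by
          refine mul_le_mul_of_nonneg_right ?_ hB0
          linarith [hB x]
      _ = 2 * B^2 := by ring
  calc _ ≤ ∑ u, ∑ v, (2 * (green P (t+1) x u)^2 * (green P (t+1) u v)^2 +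
      2 * (green P (t+1) x v)^2 * (green P (t+1) v u)^2) :=
        Finset.sum_le_sum fun u _ => Finset.sum_le_sum fun v _ => h2 u v
    _ = ∑ u, ∑ v, 2 * (green P (t+1) x u)^2 * (green P (t+1) u v)^2 +
        ∑ u, ∑ v, 2 * (green P (t+1) x u)^2 * (green P (t+1) u v)^2 := by
        simp only [Finset.sum_add_distrib]
        congr 1
        rw [Finset.sum_comm]
    _ ≤ 4 * B^2 := by linarith

lemma prod_moments {Ω : Type} [Fintype Ω] (w Φ : Ω → ℝ) (h1 : ∑ o, w o = 1)
    (h0 : ∑ o, w o * Φ o = 0) (K : ℕ) :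
    (∑ W : Fin K → Ω, ∏ k, w (W k)) = 1 ∧
    (∑ W : Fin K → Ω, (∏ k, w (W k)) * ∑ k, Φ (W k)) = 0 ∧
    (∑ W : Fin K → Ω, (∏ k, w (W k)) * (∑ k, Φ (W k))^2) = K * ∑ o, w o * (Φ o)^2 := by
  induction K with
  | zero => simp
  | succ K ih =>
    obtain ⟨a, b, c⟩ := ih
    refine ⟨?_, ?_, ?_⟩
    · rw [← (Fin.consEquiv (fun _ : Fin (K+1) => Ω)).sum_comp, Fintype.sum_prod_type]
      simp [Fin.prod_univ_succ, ← Finset.mul_sum, a, h1]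
    · rw [← (Fin.consEquiv (fun _ : Fin (K+1) => Ω)).sum_comp, Fintype.sum_prod_type]
      simp only [Fin.consEquiv_apply, Fin.prod_univ_succ, Fin.cons_zero, Fin.cons_succ,
        Fin.sum_univ_succ]
      have : ∀ o, ∑ W : Fin K → Ω, (w o * ∏ k, w (W k)) * (Φ o + ∑ k, Φ (W k)) =
          w o * Φ o := by
        intro o
        calc _ = w o * Φ o * (∑ W : Fin K → Ω, ∏ k, w (W k)) +
            w o * (∑ W : Fin K → Ω, (∏ k, w (W k)) * ∑ k, Φ (W k)) := by
              rw [Finset.mul_sum, Finset.mul_sum, ← Finset.sum_add_distrib]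
              exact Finset.sum_congr rfl fun W _ => by ring
          _ = _ := by rw [a, b]; ring
      simp only [this, h0]
    · rw [← (Fin.consEquiv (fun _ : Fin (K+1) => Ω)).sum_comp, Fintype.sum_prod_type]
      simp only [Fin.consEquiv_apply, Fin.prod_univ_succ, Fin.cons_zero, Fin.cons_succ,
        Fin.sum_univ_succ]
      have : ∀ o, ∑ W : Fin K → Ω, (w o * ∏ k, w (W k)) * (Φ o + ∑ k, Φ (W k))^2 =
          w o * (Φ o)^2 + w o * (K * ∑ o, w o * (Φ o)^2) := by
        intro o
        calc _ = w o * (Φ o)^2 * (∑ W : Fin K → Ω, ∏ k, w (W k)) +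
            2 * w o * Φ o * (∑ W : Fin K → Ω, (∏ k, w (W k)) * ∑ k, Φ (W k)) +
            w o * (∑ W : Fin K → Ω, (∏ k, w (W k)) * (∑ k, Φ (W k))^2) := by
              rw [Finset.mul_sum, Finset.mul_sum, Finset.mul_sum, ← Finset.sum_add_distrib,
                ← Finset.sum_add_distrib]
              exact Finset.sum_congr rfl fun W _ => by ring
          _ = _ := by rw [a, b, c]; ring
      simp only [this, Finset.sum_add_distrib, ← Finset.sum_mul, h1]
      push_cast
      ring

lemma EK_eq {V : Type} [Fintype V] [Nonempty V] (P : Matrix V V ℝ) (x : V)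
    (t K : ℕ) (F : (Fin K → Fin t → V) → (Fin K → Fin t → V) → ℝ) :
    EK P x t K F = ∑ W : Fin K → (Fin t → V) × (Fin t → V),
      (∏ k, (pathWeight P x t (W k).1 * pathWeight P x t (W k).2)) *
        F (fun k => (W k).1) (fun k => (W k).2) := by
  unfold EK
  rw [← (Equiv.arrowProdEquivProdArrow (Fin K) (fun _ => (Fin t → V)) (fun _ => (Fin t → V))).symm.sum_comp,
    Fintype.sum_prod_type]
  refine Finset.sum_congr rfl fun X _ => Finset.sum_congr rfl fun Y _ => ?_
  simp [Equiv.arrowProdEquivProdArrow, Finset.prod_mul_distrib]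

lemma chebyshev_EK {V : Type} [Fintype V] [Nonempty V] (P : Matrix V V ℝ)
    (hs : ∀ u, ∑ v, P u v = 1) (hp : ∀ u v, 0 ≤ P u v) (x : V)
    (t K : ℕ) (hK : 1 ≤ K) (m N B : ℝ) (hN : 0 < N)
    (hm : E2 P x x (t+1) (fun p q => nInter p q) = m)
    (hB : E2 P x x (t+1) (fun p q => (nInter p q)^2) ≤ B)
    (bad : (Fin K → Fin (t+1) → V) → (Fin K → Fin (t+1) → V) → Prop)
    (hbad : ∀ X Y, bad X Y → N ≤ |(1 / (K:ℝ)) * ∑ k, nInter (X k) (Y k) - m|) :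
    EK P x (t+1) K (fun X Y => if bad X Y then 1 else 0) ≤ B / N^2 / K := by
  have hK' : (0:ℝ) < K := by exact_mod_cast hK
  rw [EK_eq]
  set w : (Fin (t+1) → V) × (Fin (t+1) → V) → ℝ :=
    fun o => pathWeight P x (t+1) o.1 * pathWeight P x (t+1) o.2 with hw
  set Φ : (Fin (t+1) → V) × (Fin (t+1) → V) → ℝ := fun o => nInter o.1 o.2 - m with hΦ
  have hw0 : ∀ o, 0 ≤ w o := fun o =>
    mul_nonneg (pathWeight_nonneg P hp _ _ _) (pathWeight_nonneg P hp _ _ _)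
  have hw1 : ∑ o, w o = 1 := by
    have := Ew_total P hs t x
    simp only [Ew, mul_one] at this
    rw [Fintype.sum_prod_type]
    simp only [hw, ← Finset.mul_sum, this, mul_one]
  have hwm : ∑ o, w o * nInter o.1 o.2 = m := by
    rw [← hm, Fintype.sum_prod_type]; rfl
  have hwB : ∑ o, w o * (nInter o.1 o.2)^2 ≤ B := by
    refine le_trans (le_of_eq ?_) hB
    rw [Fintype.sum_prod_type]; rfl
  have hΦ0 : ∑ o, w o * Φ o = 0 := by
    simp only [hΦ, mul_sub, Finset.sum_sub_distrib, hwm, ← Finset.sum_mul, hw1]; ring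
  have hΦB : ∑ o, w o * (Φ o)^2 ≤ B := by
    have : ∑ o, w o * (Φ o)^2 = ∑ o, w o * (nInter o.1 o.2)^2 - 2 * m * ∑ o, w o * nInter o.1 o.2
        + m^2 * ∑ o, w o := by
      rw [Finset.mul_sum, Finset.mul_sum, ← Finset.sum_sub_distrib, ← Finset.sum_add_distrib]
      exact Finset.sum_congr rfl fun o _ => by simp only [hΦ]; ring
    rw [this, hwm, hw1]
    nlinarith [sq_nonneg m]
  obtain ⟨-, -, c⟩ := prod_moments w Φ hw1 hΦ0 K
  have key : ∀ W : Fin K → (Fin (t+1) → V) × (Fin (t+1) → V),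
      (∏ k, w (W k)) * (if bad (fun k => (W k).1) (fun k => (W k).2) then 1 else 0) ≤
        ((∏ k, w (W k)) * (∑ k, Φ (W k))^2) * (1 / (N^2 * K^2)) := by
    intro W
    have hw' : 0 ≤ ∏ k, w (W k) := Finset.prod_nonneg fun k _ => hw0 _
    split_ifs with h
    · rw [mul_assoc]
      refine mul_le_mul_of_nonneg_left ?_ hw'
      have h1 := hbad _ _ h
      have h2 : ∑ k, Φ (W k) = K * ((1 / (K:ℝ)) * ∑ k, nInter (W k).1 (W k).2 - m) := by
        simp only [hΦ, Finset.sum_sub_distrib]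
        simp; field_simp
      rw [h2, mul_pow]
      have h3 := pow_le_pow_left₀ hN.le h1 2
      rw [sq_abs] at h3
      rw [mul_one_div, le_div_iff₀ (by positivity)]
      nlinarith [sq_nonneg (K:ℝ)]
    · rw [mul_zero]; positivity
  calc _ ≤ ∑ W : Fin K → (Fin (t+1) → V) × (Fin (t+1) → V),
        ((∏ k, w (W k)) * (∑ k, Φ (W k))^2) * (1 / (N^2 * K^2)) :=
        Finset.sum_le_sum fun W _ => key W
    _ = (K * ∑ o, w o * (Φ o)^2) * (1 / (N^2 * K^2)) := by rw [← Finset.sum_mul, c]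
    _ ≤ (K * B) * (1 / (N^2 * K^2)) := by gcongr
    _ = B / N^2 / K := by field_simp

lemma energy_eq {V : Type} [Fintype V] (P : Matrix V V ℝ) (hs : ∀ u, ∑ v, P u v = 1)
    (hsym : ∀ u v, P u v = P v u) (f : V → ℝ) :
    ∑ u, f u ^ 2 - ∑ u, f u * ∑ v, P u v * f v = (1/2) * ∑ u, ∑ v, P u v * (f u - f v)^2 := by
  have h1 : ∑ u, ∑ v, P u v * (f u)^2 = ∑ u, f u ^2 := by
    simp only [← Finset.sum_mul, hs, one_mul]
  have h2 : ∑ u, ∑ v, P u v * (f v)^2 = ∑ u, f u ^2 := by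
    rw [Finset.sum_comm, ← h1]
    exact Finset.sum_congr rfl fun u _ => Finset.sum_congr rfl fun v _ => by rw [hsym]
  have h3 : ∑ u, ∑ v, P u v * (f u - f v)^2 = ∑ u, ∑ v, P u v * (f u)^2 +
      ∑ u, ∑ v, P u v * (f v)^2 - 2 * ∑ u, f u * ∑ v, P u v * f v := by
    simp only [Finset.mul_sum, ← Finset.sum_add_distrib, ← Finset.sum_sub_distrib]
    exact Finset.sum_congr rfl fun u _ => Finset.sum_congr rfl fun v _ => by ring
  rw [h3, h1, h2]; ring

lemma psd_of_lazy {V : Type} [Fintype V] (P : Matrix V V ℝ) (hs : ∀ u, ∑ v, P u v = 1)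
    (hp : ∀ u v, 0 ≤ P u v) (hd : ∀ u, P u u = 1/2)
    (hsym : ∀ u v, P u v = P v u) (f : V → ℝ) :
    0 ≤ ∑ u, f u * ∑ v, P u v * f v := by
  have h1 : ∑ u, ∑ v, P u v * (f u)^2 = ∑ u, f u ^2 := by
    simp only [← Finset.sum_mul, hs, one_mul]
  have h2 : ∑ u, ∑ v, P u v * (f v)^2 = ∑ u, f u ^2 := by
    rw [Finset.sum_comm, ← h1]
    exact Finset.sum_congr rfl fun u _ => Finset.sum_congr rfl fun v _ => by rw [hsym]
  have h3 : ∑ u, ∑ v, P u v * (f u + f v)^2 = ∑ u, ∑ v, P u v * (f u)^2 +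
      ∑ u, ∑ v, P u v * (f v)^2 + 2 * ∑ u, f u * ∑ v, P u v * f v := by
    simp only [Finset.mul_sum, ← Finset.sum_add_distrib]
    exact Finset.sum_congr rfl fun u _ => Finset.sum_congr rfl fun v _ => by ring
  have h4 : 2 * ∑ u, f u ^2 ≤ ∑ u, ∑ v, P u v * (f u + f v)^2 := by
    rw [Finset.mul_sum]
    refine Finset.sum_le_sum fun u _ => ?_
    have := Finset.single_le_sum (f := fun v => P u v * (f u + f v)^2)
      (fun v _ => mul_nonneg (hp u v) (sq_nonneg _)) (Finset.mem_univ u)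
    refine le_trans (le_of_eq ?_) this
    simp only [hd]; ring
  linarith

lemma pow_rowsum {V : Type} [Fintype V] (P : Matrix V V ℝ) (hs : ∀ u, ∑ v, P u v = 1) (k : ℕ) :
    ∀ u, ∑ v, (P^k) u v = 1 := by
  induction k with
  | zero => intro u; simp [Matrix.one_apply]
  | succ k ih =>
    intro u
    simp only [pow_succ, Matrix.mul_apply]
    rw [Finset.sum_comm]
    simp only [← Finset.mul_sum, hs, mul_one, ih]

lemma pow_symm_entry {V : Type} [Fintype V] (P : Matrix V V ℝ)
    (hsym : ∀ u v, P u v = P v u) (k : ℕ) (u v : V) : (P^k) u v = (P^k) v u := by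
  have h : P.transpose = P := by ext a b; exact hsym b a
  have h2 : (P^k).transpose = P^k := by rw [Matrix.transpose_pow, h]
  have := congrFun (congrFun h2 v) u
  simpa [Matrix.transpose_apply] using this

lemma diag_lower {V : Type} [Fintype V] [Nonempty V] (P : Matrix V V ℝ)
    (hs : ∀ u, ∑ v, P u v = 1)
    (hp : ∀ u v, 0 ≤ P u v) (hd : ∀ u, P u u = 1/2)
    (hsym : ∀ u v, P u v = P v u) (x : V) (m : ℕ) :
    1 / (Fintype.card V : ℝ) ≤ (P^m) x x := by
  have hn : (0:ℝ) < Fintype.card V := by exact_mod_cast Fintype.card_pos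
  rcases Nat.even_or_odd' m with ⟨s, rfl | rfl⟩
  · have h1 : (P^(2*s)) x x = ∑ v, ((P^s) x v)^2 := by
      rw [two_mul, pow_add, Matrix.mul_apply]
      exact Finset.sum_congr rfl fun v _ => by rw [pow_symm_entry P hsym s v x]; ring
    have h2 := sq_sum_le_card_mul_sum_sq (s := Finset.univ) (f := fun v => (P^s) x v)
    rw [pow_rowsum P hs, ← h1, Finset.card_univ] at h2
    rw [div_le_iff₀ hn]; linarith
  · set f : V → ℝ := fun v => (P^s) x v with hf
    have h1 : (P^(2*s+1)) x x = ∑ u, f u * ∑ v, P u v * f v := by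
      have : 2 * s + 1 = s + (1 + s) := by ring
      rw [this, pow_add, pow_add, pow_one, Matrix.mul_apply]
      refine Finset.sum_congr rfl fun u _ => ?_
      rw [Matrix.mul_apply]
      congr 1
      exact Finset.sum_congr rfl fun v _ => by rw [pow_symm_entry P hsym s v x]
    have hf1 : ∑ u, f u = 1 := pow_rowsum P hs s x
    set c := 1 / (Fintype.card V : ℝ) with hc
    have h2 := psd_of_lazy P hs hp hd hsym (fun u => f u - c)
    have h3 : ∑ u, ∑ v, P u v * f v = 1 := by
      rw [Finset.sum_comm, ← hf1]
      refine Finset.sum_congr rfl fun v _ => ?_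
      rw [← Finset.sum_mul]
      simp only [fun u => hsym u v, hs, one_mul]
    have h4 : ∑ u, (f u - c) * ∑ v, P u v * (f v - c) = (∑ u, f u * ∑ v, P u v * f v)
        - c * ∑ u, f u - c * (∑ u, ∑ v, P u v * f v) + c * c * Fintype.card V := by
      have h5 : ∀ u, ∑ v, P u v * (f v - c) = (∑ v, P u v * f v) - c := by
        intro u
        simp only [mul_sub, Finset.sum_sub_distrib, ← Finset.sum_mul, hs, one_mul]
      simp only [h5]
      rw [Finset.mul_sum, Finset.mul_sum, ← Finset.sum_sub_distrib, ← Finset.sum_sub_distrib]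
      have : c * c * (Fintype.card V : ℝ) = ∑ _u : V, c * c := by simp; ring
      rw [this, ← Finset.sum_add_distrib]
      exact Finset.sum_congr rfl fun u _ => by ring
    have h6 : c * Fintype.card V = 1 := by rw [hc]; field_simp
    rw [h4, hf1, h3, mul_assoc, h6] at h2
    rw [h1]; linarith

lemma lazy_diag {V : Type} [Fintype V] (G : SimpleGraph V) (u : V) : lazyP G u u = 1/2 := by
  simp [lazyP]

lemma lazy_adj {V : Type} [Fintype V] (G : SimpleGraph V) (d : ℕ) (hd : ∀ u, G.degree u = d)
    (u v : V) (h : G.Adj u v) : lazyP G u v = 1 / (2 * (d:ℝ)) := by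
  simp [lazyP, h, h.ne, hd]

lemma lazy_nonneg {V : Type} [Fintype V] (G : SimpleGraph V) (u v : V) : 0 ≤ lazyP G u v := by
  unfold lazyP; split_ifs <;> positivity

lemma lazy_symm {V : Type} [Fintype V] (G : SimpleGraph V) (d : ℕ) (hd : ∀ u, G.degree u = d)
    (u v : V) : lazyP G u v = lazyP G v u := by
  unfold lazyP
  simp only [hd, G.adj_comm u v, eq_comm (a := u) (b := v)]

lemma lazy_row {V : Type} [Fintype V] (G : SimpleGraph V) (d : ℕ) (hd : ∀ u, G.degree u = d)
    (f : V → ℝ) (u : V) :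
    ∑ v, lazyP G u v * f v = (1/2) * f u + (1 / (2*(d:ℝ))) * ∑ v ∈ G.neighborFinset u, f v := by
  have h1 : ∀ v, lazyP G u v * f v = (if u = v then (1/2) * f v else 0) +
      (if G.Adj u v then (1 / (2*(d:ℝ))) * f v else 0) := by
    intro v
    unfold lazyP
    rw [hd]
    by_cases h : u = v
    · subst h; simp
    · simp [h]
  simp only [h1, Finset.sum_add_distrib]
  rw [Finset.sum_ite_eq, Finset.mul_sum, ← Finset.sum_filter, ← SimpleGraph.neighborFinset_eq_filter]
  simp

lemma lazy_sum {V : Type} [Fintype V] (G : SimpleGraph V) (d : ℕ) (hd : ∀ u, G.degree u = d)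
    (hd0 : 0 < d) (u : V) : ∑ v, lazyP G u v = 1 := by
  have h := lazy_row G d hd (fun _ => 1) u
  have : (0:ℝ) < d := by exact_mod_cast hd0
  simp only [mul_one, Finset.sum_const, SimpleGraph.card_neighborFinset_eq_degree, hd, nsmul_eq_mul] at h
  rw [h]; field_simp; norm_num

lemma const_of_energy {V : Type} [Fintype V] (G : SimpleGraph V) (d : ℕ)
    (hd : ∀ u, G.degree u = d) (hd0 : 0 < d) (hc : G.Connected) (f : V → ℝ)
    (h : ∑ u, ∑ v, lazyP G u v * (f u - f v)^2 = 0) (u v : V) : f u = f v := by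
  have h1 : ∀ u v, lazyP G u v * (f u - f v)^2 = 0 := by
    intro u v
    have hnn : ∀ u v, 0 ≤ lazyP G u v * (f u - f v)^2 :=
      fun u v => mul_nonneg (lazy_nonneg G u v) (sq_nonneg _)
    have h2 := (Finset.sum_eq_zero_iff_of_nonneg
      (fun u _ => Finset.sum_nonneg fun v _ => hnn u v)).1 h u (Finset.mem_univ _)
    exact (Finset.sum_eq_zero_iff_of_nonneg (fun v _ => hnn u v)).1 h2 v (Finset.mem_univ _)
  have h2 : ∀ u v, G.Adj u v → f u = f v := by
    intro u v huv
    have := h1 u v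
    rw [lazy_adj G d hd u v huv] at this
    have hd' : (0:ℝ) < d := by exact_mod_cast hd0
    have h3 : (f u - f v)^2 = 0 := by
      rcases mul_eq_zero.1 this with h | h
      · exfalso; have : 0 < 1 / (2*(d:ℝ)) := by positivity
        linarith
      · exact h
    nlinarith [pow_eq_zero_iff (two_ne_zero) |>.1 h3]
  obtain ⟨p⟩ := hc.preconnected u v
  induction p with
  | nil => rfl
  | cons hadj p ih => exact (h2 _ _ hadj).trans ih

lemma spectral_setup {V : Type} [Fintype V] (P : Matrix V V ℝ)
    (hsym : ∀ u v, P u v = P v u) : ∃ (e : V → V → ℝ) (l : V → ℝ),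
      (∀ j, e j ≠ 0) ∧ (∀ j u, ∑ v, P u v * e j v = l j * e j u) ∧
      (∀ f g : V → ℝ, ∑ u, f u * g u = ∑ j, (∑ u, e j u * f u) * (∑ u, e j u * g u)) := by
  have hA : P.IsHermitian := by
    ext u v; simp [Matrix.conjTranspose_apply, hsym u v]
  refine ⟨fun j u => hA.eigenvectorBasis j u, hA.eigenvalues, ?_, ?_, ?_⟩
  · intro j h
    have : hA.eigenvectorBasis j = 0 := by
      ext u; exact congrFun h u
    exact hA.eigenvectorBasis.orthonormal.ne_zero j this
  · intro j u
    have := congrFun (hA.mulVec_eigenvectorBasis j) u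
    simpa [Matrix.mulVec, dotProduct] using this
  · intro f g
    have := hA.eigenvectorBasis.sum_inner_mul_inner (WithLp.toLp 2 f) (WithLp.toLp 2 g)
    simp only [PiLp.inner_apply] at this
    simp only [RCLike.inner_apply, conj_trivial] at this
    rw [show ∑ u, f u * g u = ∑ u, g u * f u from Finset.sum_congr rfl fun u _ => mul_comm _ _]
    rw [← this]
    refine Finset.sum_congr rfl fun j _ => ?_
    congr 1
    exact Finset.sum_congr rfl fun u _ => mul_comm _ _

lemma poincare {V : Type} [Fintype V] (G : SimpleGraph V) (d : ℕ)
    (hd : ∀ u, G.degree u = d) (hd0 : 0 < d) (hc : G.Connected) :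
    1 ≤ relTime (lazyP G) ∧ ∀ f : V → ℝ, ∑ u, f u = 0 →
      ∑ u, f u ^ 2 ≤ (relTime (lazyP G) : ℝ) *
        (∑ u, f u ^ 2 - ∑ u, f u * ∑ v, lazyP G u v * f v) := by
  set P := lazyP G with hP
  have hs : ∀ u, ∑ v, P u v = 1 := lazy_sum G d hd hd0
  have hsym : ∀ u v, P u v = P v u := lazy_symm G d hd
  have hp : ∀ u v, 0 ≤ P u v := lazy_nonneg G
  obtain ⟨e, l, he0, hel, hpar⟩ := spectral_setup P hsym
  have hcoef : ∀ (f : V → ℝ) j, ∑ u, e j u * ∑ v, P u v * f v = l j * ∑ u, e j u * f u := by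
    intro f j
    simp only [Finset.mul_sum]
    rw [Finset.sum_comm]
    refine Finset.sum_congr rfl fun v _ => ?_
    calc ∑ u, e j u * (P u v * f v) = (∑ u, P v u * e j u) * f v := by
          rw [Finset.sum_mul]
          exact Finset.sum_congr rfl fun u _ => by rw [hsym u v]; ring
      _ = _ := by rw [hel]; ring
  set S := {r : ℝ | r ≠ 1 ∧ ∃ f : V → ℝ, f ≠ 0 ∧ P.mulVec f = r • f} with hS
  have hfin : S.Finite := by
    refine (Set.finite_range l).subset ?_
    rintro r ⟨-, f, hf0, hf⟩
    have hf' : ∀ u, ∑ v, P u v * f v = r * f u := fun u => congrFun hf u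
    by_contra hr
    have hz : ∀ j, ∑ u, e j u * f u = 0 := by
      intro j
      have h1 := hcoef f j
      simp only [hf'] at h1
      have h2 : ∑ u, e j u * (r * f u) = r * ∑ u, e j u * f u := by
        rw [Finset.mul_sum]; exact Finset.sum_congr rfl fun u _ => by ring
      rw [h2] at h1
      have h3 : (r - l j) * ∑ u, e j u * f u = 0 := by linarith
      rcases mul_eq_zero.1 h3 with h | h
      · exact absurd ⟨j, by linarith⟩ hr
      · exact h
    have h4 := hpar f f
    simp only [hz, mul_zero, Finset.sum_const_zero] at h4
    apply hf0
    funext u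
    have := (Finset.sum_eq_zero_iff_of_nonneg (fun u _ => mul_self_nonneg (f u))).1 h4 u
      (Finset.mem_univ _)
    simpa using this
  have hen : ∀ f : V → ℝ, 0 ≤ ∑ u, ∑ v, P u v * (f u - f v)^2 := fun f =>
    Finset.sum_nonneg fun u _ => Finset.sum_nonneg fun v _ => mul_nonneg (hp u v) (sq_nonneg _)
  have hle1 : ∀ r ∈ S, r < 1 := by
    rintro r ⟨h1, f, hf0, hf⟩
    have hf' : ∀ u, ∑ v, P u v * f v = r * f u := fun u => congrFun hf u
    refine lt_of_le_of_ne ?_ h1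
    have h2 := energy_eq P hs hsym f
    simp only [hf'] at h2
    have h3 : ∑ u, f u * (r * f u) = r * ∑ u, f u ^ 2 := by
      rw [Finset.mul_sum]; exact Finset.sum_congr rfl fun u _ => by ring
    rw [h3] at h2
    have h4 := hen f
    have h5 : 0 < ∑ u, f u ^ 2 := by
      obtain ⟨u, hu⟩ := Function.ne_iff.1 hf0
      exact Finset.sum_pos' (fun u _ => sq_nonneg _) ⟨u, Finset.mem_univ _, by
        have : f u ≠ 0 := hu
        positivity⟩
    by_contra h6
    push Not at h6
    nlinarith
  have hl2 : secondEig P < 1 := by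
    unfold secondEig
    rcases S.eq_empty_or_nonempty with h | h
    · rw [← hS, h, Real.sSup_empty]; norm_num
    · exact hle1 _ (h.csSup_mem hfin)
  have hT : 1 / (1 - secondEig P) ≤ (relTime P : ℝ) := Nat.le_ceil _
  have hpos : 0 < 1 / (1 - secondEig P) := by
    apply one_div_pos.2; linarith
  have hTpos : (0:ℝ) < relTime P := lt_of_lt_of_le hpos hT
  refine ⟨by exact_mod_cast hTpos, ?_⟩
  intro f hf
  have h1 : ∑ u, f u ^2 = ∑ j, (∑ u, e j u * f u)^2 := by
    have := hpar f f
    simpa only [← sq] using this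
  have h2 : ∑ u, f u * ∑ v, P u v * f v = ∑ j, l j * (∑ u, e j u * f u)^2 := by
    rw [hpar f (fun u => ∑ v, P u v * f v)]
    exact Finset.sum_congr rfl fun j _ => by rw [hcoef]; ring
  have h3 : (1 - secondEig P) * ∑ j, (∑ u, e j u * f u)^2 ≤
      ∑ j, (∑ u, e j u * f u)^2 - ∑ j, l j * (∑ u, e j u * f u)^2 := by
    rw [Finset.mul_sum, ← Finset.sum_sub_distrib]
    refine Finset.sum_le_sum fun j _ => ?_
    by_cases hj : l j = 1
    · have h4 := energy_eq P hs hsym (e j)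
      simp only [hel, hj, one_mul] at h4
      simp only [← sq, sub_self] at h4
      have h5 : ∀ u v, e j u = e j v :=
        const_of_energy G d hd hd0 hc (e j) (by linarith)
      have h6 : ∑ u, e j u * f u = 0 := by
        obtain ⟨x⟩ := hc.nonempty
        simp only [fun u => h5 u x, ← Finset.mul_sum, hf, mul_zero]
      rw [h6]; simp
    · have h4 : l j ∈ S := ⟨hj, e j, he0 j, by
        funext u
        simpa [Matrix.mulVec, dotProduct] using hel j u⟩
      have h5 : l j ≤ secondEig P := le_csSup hfin.bddAbove h4
      nlinarith [sq_nonneg (∑ u, e j u * f u)]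
  rw [h2, h1]
  have h7 : 0 < 1 - secondEig P := by linarith
  rw [div_le_iff₀ h7] at hT
  have h8 : 0 ≤ ∑ j, (∑ u, e j u * f u)^2 := Finset.sum_nonneg fun j _ => sq_nonneg _
  calc _ ≤ (relTime P * (1 - secondEig P)) * ∑ j, (∑ u, e j u * f u)^2 := by nlinarith
    _ = relTime P * ((1 - secondEig P) * ∑ j, (∑ u, e j u * f u)^2) := by ring
    _ ≤ _ := mul_le_mul_of_nonneg_left h3 hTpos.le

lemma geo_path {V : Type} [Fintype V] (G : SimpleGraph V) (d : ℕ)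
    (hd : ∀ u, G.degree u = d) (hc : G.Connected) (x : V) (S : Finset V)
    (hS : ∃ y, y ∉ S) : ∃ (L : ℕ) (u : ℕ → V), u 0 = x ∧ u L ∉ S ∧
      (∀ i < L, G.Adj (u i) (u (i+1))) ∧ (∀ i ≤ L, G.dist x (u i) = i) ∧
      d * L ≤ d + 3 * S.card := by
  obtain ⟨y, hy, hmin⟩ := Finset.exists_min_image (Sᶜ) (fun y => G.dist x y)
    (by obtain ⟨y, hy⟩ := hS; exact ⟨y, by simpa using hy⟩)
  obtain ⟨p, hp⟩ := hc.exists_walk_length_eq_dist x y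
  have hS' : ∀ v, G.dist x v < p.length → v ∈ S := by
    intro v hv
    by_contra h
    have := hmin v (by simpa using h)
    omega
  have hadj : ∀ i < p.length, G.Adj (p.getVert i) (p.getVert (i+1)) :=
    fun i hi => p.adj_getVert_succ hi
  have htri : ∀ a b, G.Adj a b → G.dist x b ≤ G.dist x a + 1 := by
    intro a b h
    have := hc.dist_triangle (u := x) (v := a) (w := b)
    rw [SimpleGraph.dist_eq_one_iff_adj.2 h] at this
    exact this
  have hle : ∀ i ≤ p.length, G.dist x (p.getVert i) ≤ i := by
    intro i
    induction i with
    | zero => simp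
    | succ i ih =>
      intro hi
      have := htri _ _ (hadj i (by omega))
      have := ih (by omega)
      omega
  have hge : ∀ k, k ≤ p.length → p.length ≤ G.dist x (p.getVert (p.length - k)) + k := by
    intro k
    induction k with
    | zero => intro _; rw [Nat.sub_zero, p.getVert_length, hp]; omega
    | succ k ih =>
      intro hk
      have h1 := htri _ _ (hadj (p.length - (k+1)) (by omega))
      have h2 : p.length - (k+1) + 1 = p.length - k := by omega
      rw [h2] at h1
      have := ih (by omega)
      omega
  have hdist : ∀ i ≤ p.length, G.dist x (p.getVert i) = i := by
    intro i hi
    have h1 := hle i hi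
    have h2 := hge (p.length - i) (by omega)
    have h3 : p.length - (p.length - i) = i := by omega
    rw [h3] at h2
    omega
  refine ⟨p.length, p.getVert, p.getVert_zero, by simpa using hy, hadj, hdist, ?_⟩
  have hcount : (p.length - 1) * d ≤ 3 * S.card := by
    have h1 : ∀ i ∈ Finset.range (p.length - 1),
        d = ∑ v ∈ S, if G.Adj (p.getVert i) v then 1 else 0 := by
      intro i hi
      have hi := Finset.mem_range.1 hi
      rw [← Finset.sum_filter, Finset.sum_const, smul_eq_mul, mul_one, ← hd (p.getVert i),
        ← SimpleGraph.card_neighborFinset_eq_degree]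
      congr 1
      ext v
      simp only [SimpleGraph.mem_neighborFinset, Finset.mem_filter]
      refine ⟨fun h => ⟨hS' v ?_, h⟩, fun h => h.2⟩
      have := htri _ _ h
      have := hdist i (by omega)
      omega
    calc (p.length - 1) * d = ∑ i ∈ Finset.range (p.length - 1), d := by simp
      _ = ∑ i ∈ Finset.range (p.length - 1), ∑ v ∈ S, (if G.Adj (p.getVert i) v then 1 else 0) :=
          Finset.sum_congr rfl h1
      _ = ∑ v ∈ S, ∑ i ∈ Finset.range (p.length - 1), (if G.Adj (p.getVert i) v then 1 else 0) :=
          Finset.sum_comm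
      _ ≤ ∑ v ∈ S, 3 := by
          refine Finset.sum_le_sum fun v _ => ?_
          rw [← Finset.sum_filter, Finset.sum_const, smul_eq_mul, mul_one]
          calc _ ≤ (Finset.Icc (G.dist x v - 1) (G.dist x v + 1)).card := by
                refine Finset.card_le_card fun i hi => ?_
                simp only [Finset.mem_filter, Finset.mem_range, Finset.mem_Icc] at hi ⊢
                have h1 := htri _ _ hi.2
                have h2 := htri _ _ hi.2.symm
                have h3 := hdist i (by omega)
                omega
            _ ≤ 3 := by rw [Nat.card_Icc]; omega
      _ = 3 * S.card := by simp; ring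
  rcases Nat.eq_zero_or_pos p.length with h | h
  · rw [h]; omega
  · obtain ⟨m, hm⟩ : ∃ m, p.length = m + 1 := ⟨p.length - 1, by omega⟩
    rw [hm] at hcount ⊢
    simp at hcount
    nlinarith

lemma path_energy {V : Type} [Fintype V] (G : SimpleGraph V) (d : ℕ)
    (hd : ∀ u, G.degree u = d) (hd0 : 0 < d) (x : V) (L : ℕ) (u : ℕ → V)
    (hadj : ∀ i < L, G.Adj (u i) (u (i+1))) (hdist : ∀ i ≤ L, G.dist x (u i) = i) (f : V → ℝ) :
    (f (u 0) - f (u L))^2 ≤ 2 * d * L * ∑ a, ∑ b, lazyP G a b * (f a - f b)^2 := by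
  have hd' : (0:ℝ) < d := by exact_mod_cast hd0
  have h1 : f (u 0) - f (u L) = ∑ i ∈ Finset.range L, (f (u i) - f (u (i+1))) :=
    (Finset.sum_range_sub' (fun i => f (u i)) L).symm
  have h2 := sq_sum_le_card_mul_sum_sq (s := Finset.range L) (f := fun i => f (u i) - f (u (i+1)))
  rw [← h1, Finset.card_range] at h2
  have h3 : ∑ i ∈ Finset.range L, (f (u i) - f (u (i+1)))^2 =
      2 * d * ∑ i ∈ Finset.range L, lazyP G (u i) (u (i+1)) * (f (u i) - f (u (i+1)))^2 := by
    rw [Finset.mul_sum]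
    refine Finset.sum_congr rfl fun i hi => ?_
    rw [lazy_adj G d hd _ _ (hadj i (Finset.mem_range.1 hi))]
    field_simp
  have h4 : ∑ i ∈ Finset.range L, lazyP G (u i) (u (i+1)) * (f (u i) - f (u (i+1)))^2 ≤
      ∑ a, ∑ b, lazyP G a b * (f a - f b)^2 := by
    rw [← Fintype.sum_prod_type' (f := fun a b => lazyP G a b * (f a - f b)^2)]
    rw [← Finset.sum_image (f := fun ab : V × V => lazyP G ab.1 ab.2 * (f ab.1 - f ab.2)^2)
      (g := fun i => (u i, u (i+1)))]
    · exact Finset.sum_le_sum_of_subset_of_nonneg (Finset.subset_univ _)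
        fun ab _ _ => mul_nonneg (lazy_nonneg G _ _) (sq_nonneg _)
    · intro i hi j hj h
      simp only [Finset.coe_range, Set.mem_Iio] at hi hj
      have h5 : u i = u j := (Prod.ext_iff.1 h).1
      rw [← hdist i hi.le, ← hdist j hj.le, h5]
  calc _ ≤ (L:ℝ) * (2 * d * ∑ i ∈ Finset.range L, lazyP G (u i) (u (i+1)) * (f (u i) - f (u (i+1)))^2) := by
        rw [← h3]; exact h2
    _ ≤ (L:ℝ) * (2 * d * ∑ a, ∑ b, lazyP G a b * (f a - f b)^2) := by gcongr
    _ = _ := by ring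

lemma geo_bound {V : Type} [Fintype V] (G : SimpleGraph V) (d : ℕ)
    (hd : ∀ u, G.degree u = d) (hd0 : 0 < d) (hc : G.Connected) (x : V) (f : V → ℝ) (T : ℝ)
    (hT : 1 ≤ T) (hf0 : ∑ u, f u = 0) (hfx : 0 ≤ f x)
    (hle : ∀ u, f u ≤ f x)
    (hen : ∑ u, f u ^ 2 - ∑ u, f u * ∑ v, lazyP G u v * f v ≤ f x)
    (hnorm : ∑ u, f u ^ 2 ≤ T * f x)
    (hloc : f x - ∑ v, lazyP G x v * f v ≤ 1) : (f x)^2 ≤ 324 * T := by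
  rcases hfx.eq_or_lt with h0 | hM
  · rw [← h0]; nlinarith
  set M := f x with hMdef
  have hd' : (0:ℝ) < d := by exact_mod_cast hd0
  set S : Finset V := Finset.univ.filter (fun u => M / 2 ≤ f u) with hS
  have hy : ∃ y, y ∉ S := by
    by_contra h
    push Not at h
    have h1 : ∀ u, M/2 ≤ f u := fun u => by simpa [hS] using h u
    have : 0 < ∑ u, f u := Finset.sum_pos (fun u _ => by linarith [h1 u]) ⟨x, Finset.mem_univ _⟩
    linarith
  have hcard : (S.card : ℝ) * M ≤ 4 * T := by
    have h1 : (S.card : ℝ) * (M/2)^2 ≤ ∑ u, f u ^2 := by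
      calc (S.card : ℝ) * (M/2)^2 = ∑ u ∈ S, (M/2)^2 := by simp
        _ ≤ ∑ u ∈ S, f u ^2 := by
          refine Finset.sum_le_sum fun u hu => ?_
          have : M/2 ≤ f u := by simpa [hS] using hu
          exact pow_le_pow_left₀ (by linarith) this 2
        _ ≤ _ := Finset.sum_le_sum_of_subset_of_nonneg (Finset.subset_univ _)
          fun u _ _ => sq_nonneg _
    have h2 : (S.card : ℝ) * M * M ≤ 4 * T * M := by nlinarith
    exact le_of_mul_le_mul_right h2 hM
  by_cases hcase : 2 * S.card ≤ d
  · -- many neighbours outside S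
    have hrow := lazy_row G d hd f x
    have hnb : ∑ v ∈ G.neighborFinset x, f v ≤ d * (M/2) + (S.card:ℝ) * (M/2) := by
      calc ∑ v ∈ G.neighborFinset x, f v
          ≤ ∑ v ∈ G.neighborFinset x, (M/2 + if v ∈ S then M/2 else 0) := by
            refine Finset.sum_le_sum fun v _ => ?_
            split_ifs with h
            · have := hle v; linarith
            · have : ¬ (M/2 ≤ f v) := by simpa [hS] using h
              linarith
        _ = d * (M/2) + ∑ v ∈ G.neighborFinset x, (if v ∈ S then M/2 else 0) := by
            rw [Finset.sum_add_distrib, Finset.sum_const,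
              SimpleGraph.card_neighborFinset_eq_degree, hd, nsmul_eq_mul]
        _ ≤ d * (M/2) + ∑ v, (if v ∈ S then M/2 else 0) := by
            refine add_le_add le_rfl (Finset.sum_le_sum_of_subset_of_nonneg
              (Finset.subset_univ _) fun v _ _ => ?_)
            split_ifs <;> linarith
        _ = _ := by
            congr 1
            rw [← Finset.sum_filter]; simp
    have hc2 : (2:ℝ) * S.card ≤ d := by exact_mod_cast hcase
    have h3 : ∑ v ∈ G.neighborFinset x, f v ≤ d * (3/4 * M) := by nlinarith
    have h4 : (1 / (2*(d:ℝ))) * ∑ v ∈ G.neighborFinset x, f v ≤ 3/8 * M := by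
      rw [div_mul_eq_mul_div, one_mul, div_le_iff₀ (by positivity)]
      nlinarith
    have h5 : M ≤ 8 := by rw [hrow] at hloc; linarith
    nlinarith
  · push Not at hcase
    obtain ⟨L, u, hu0, huL, hadj, hdist, hL⟩ := geo_path G d hd hc x S hy
    have h1 := path_energy G d hd hd0 x L u hadj hdist f
    rw [energy_eq (lazyP G) (lazy_sum G d hd hd0) (lazy_symm G d hd)] at hen
    have h2 : ¬ (M/2 ≤ f (u L)) := by simpa [hS] using huL
    rw [hu0] at h1
    have h3 : (M/2)^2 ≤ (f x - f (u L))^2 := by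
      refine pow_le_pow_left₀ (by linarith) ?_ 2
      linarith
    have hL' : (d:ℝ) * L ≤ d + 3 * S.card := by exact_mod_cast hL
    have hc2 : (d:ℝ) < 2 * S.card := by exact_mod_cast hcase
    have h4 : (d:ℝ) * L ≤ 5 * S.card := by linarith
    have h5 : ∑ a, ∑ b, lazyP G a b * (f a - f b)^2 ≤ 2 * M := by linarith
    have h6 : (M/2)^2 ≤ 2 * (5 * S.card) * (2 * M) := by
      calc (M/2)^2 ≤ 2 * d * L * ∑ a, ∑ b, lazyP G a b * (f a - f b)^2 := h3.trans h1
        _ ≤ 2 * d * L * (2 * M) := by gcongr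
        _ = 2 * (d * L) * (2 * M) := by ring
        _ ≤ _ := by gcongr
    nlinarith

lemma green_max {V : Type} [Fintype V] (P : Matrix V V ℝ) (hs : ∀ u, ∑ v, P u v = 1)
    (hp : ∀ u v, 0 ≤ P u v) (x : V) (t : ℕ) : ∀ u, green P t u x ≤ green P t x x := by
  induction t with
  | zero => intro u; simp [green]
  | succ t ih =>
    intro u
    by_cases h : u = x
    · rw [h]
    have h1 : green P (t+1) u x = ∑ v, P u v * green P t v x := by
      unfold green
      rw [Finset.sum_range_succ']
      simp only [pow_succ', Matrix.mul_apply, Finset.mul_sum]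
      rw [Finset.sum_comm, pow_zero, Matrix.one_apply, if_neg h, add_zero]
    have h2 : ∑ v, P u v * green P t v x ≤ ∑ v, P u v * green P t x x :=
      Finset.sum_le_sum fun v _ => mul_le_mul_of_nonneg_left (ih v) (hp u v)
    rw [← Finset.sum_mul, hs, one_mul] at h2
    have h3 : green P t x x ≤ green P (t+1) x x := by
      unfold green
      rw [Finset.sum_range_succ]
      linarith [pow_nonneg_entry P hp t x x]
    linarith

lemma green_bound {V : Type} [Fintype V] (G : SimpleGraph V) (d : ℕ)
    (hd : ∀ u, G.degree u = d) (hd0 : 0 < d) (hc : G.Connected) (x : V) (t : ℕ) :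
    (t:ℝ)^2 / (Fintype.card V : ℝ) ≤ ∑ u, (green (lazyP G) t x u)^2 ∧
    ∑ u, (green (lazyP G) t x u)^2 ≤ (t:ℝ)^2 / (Fintype.card V : ℝ) +
      18 * ((relTime (lazyP G) : ℝ) * Real.sqrt (relTime (lazyP G))) := by
  have := hc.nonempty
  obtain ⟨hT, hpoin⟩ := poincare G d hd hd0 hc
  set P := lazyP G with hP
  have hs : ∀ u, ∑ v, P u v = 1 := lazy_sum G d hd hd0
  have hsym : ∀ u v, P u v = P v u := lazy_symm G d hd
  have hp : ∀ u v, 0 ≤ P u v := lazy_nonneg G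
  have hdiag : ∀ u, P u u = 1/2 := lazy_diag G
  have hn : (0:ℝ) < Fintype.card V := by exact_mod_cast Fintype.card_pos
  set T : ℝ := (relTime P : ℝ) with hTdef
  have hT1 : 1 ≤ T := by rw [hTdef]; exact_mod_cast hT
  set n : ℝ := (Fintype.card V : ℝ) with hndef
  set w : V → ℝ := fun u => green P t x u - t / n with hw
  have hgsum : ∑ u, green P t x u = t := by
    unfold green
    rw [Finset.sum_comm]
    simp [pow_rowsum P hs]
  have hconst : ∑ _u : V, (t:ℝ) / n = t := by
    simp only [Finset.sum_const, Finset.card_univ, nsmul_eq_mul]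
    rw [← hndef]; field_simp
  have hw0 : ∑ u, w u = 0 := by
    simp only [hw, Finset.sum_sub_distrib, hgsum, hconst, sub_self]
  have hsq : ∑ u, (green P t x u)^2 = (t:ℝ)^2/n + ∑ u, w u ^2 := by
    have h1 : ∀ u, (green P t x u)^2 = w u ^2 + 2 * (t/n) * w u + (t/n) * (t/n) := by
      intro u; simp only [hw]; ring
    simp only [h1, Finset.sum_add_distrib, ← Finset.mul_sum, hw0, hconst]
    ring
  have hgr : ∀ u, green P t x u - ∑ v, P u v * green P t x v =
      (if u = x then 1 else 0) - (P^t) x u := by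
    intro u
    have h1 : ∑ v, P u v * green P t x v = ∑ i ∈ Finset.range t, (P^(i+1)) x u := by
      unfold green
      simp only [Finset.mul_sum]
      rw [Finset.sum_comm]
      refine Finset.sum_congr rfl fun i _ => ?_
      rw [pow_succ, Matrix.mul_apply]
      exact Finset.sum_congr rfl fun v _ => by rw [hsym u v]; ring
    rw [h1]
    unfold green
    rw [← Finset.sum_sub_distrib, Finset.sum_range_sub' (fun i => (P^i) x u), pow_zero,
      Matrix.one_apply]
    simp only [eq_comm]
  have hwr : ∀ u, w u - ∑ v, P u v * w v = (if u = x then 1 else 0) - (P^t) x u := by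
    intro u
    rw [← hgr u]
    simp only [hw, mul_sub, Finset.sum_sub_distrib, ← Finset.sum_mul, hs]
    ring
  have hPtw : 0 ≤ ∑ u, w u * (P^t) x u := by
    have h1 : ∑ u, w u * (P^t) x u = ∑ i ∈ Finset.range t, ((P^(i+t)) x x - 1/n) := by
      simp only [hw, sub_mul, Finset.sum_sub_distrib, ← Finset.mul_sum, pow_rowsum P hs]
      congr 1
      · unfold green
        simp only [Finset.sum_mul]
        rw [Finset.sum_comm]
        refine Finset.sum_congr rfl fun i _ => ?_
        rw [pow_add, Matrix.mul_apply]
        exact Finset.sum_congr rfl fun v _ => by rw [pow_symm_entry P hsym t x v]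
      · simp; ring
    rw [h1]
    exact Finset.sum_nonneg fun i _ => by
      have := diag_lower P hs hp hdiag hsym x (i+t)
      linarith
  have hen : ∑ u, w u ^ 2 - ∑ u, w u * ∑ v, P u v * w v ≤ w x := by
    have h1 : ∑ u, w u ^ 2 - ∑ u, w u * ∑ v, P u v * w v = w x - ∑ u, w u * (P^t) x u := by
      rw [← Finset.sum_sub_distrib]
      have h2 : ∀ u, w u ^2 - w u * ∑ v, P u v * w v =
          (if u = x then w u else 0) - w u * (P^t) x u := by
        intro u
        have : w u ^2 - w u * ∑ v, P u v * w v = w u * (w u - ∑ v, P u v * w v) := by ring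
        rw [this, hwr u, mul_sub, mul_ite, mul_one, mul_zero]
      simp only [h2, Finset.sum_sub_distrib]
      simp
    linarith
  have hnorm : ∑ u, w u ^2 ≤ T * w x :=
    (hpoin w hw0).trans (mul_le_mul_of_nonneg_left hen (by linarith))
  have hnn : 0 ≤ ∑ u, w u ^2 := Finset.sum_nonneg fun u _ => sq_nonneg _
  have hwx : 0 ≤ w x := by
    by_contra h
    push Not at h
    nlinarith
  have hle : ∀ u, w u ≤ w x := by
    intro u
    have h1 : green P t x u = green P t u x :=
      Finset.sum_congr rfl fun i _ => pow_symm_entry P hsym i x u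
    have := green_max P hs hp x t u
    simp only [hw]; linarith
  have hloc : w x - ∑ v, P x v * w v ≤ 1 := by
    rw [hwr x, if_pos rfl]
    linarith [pow_nonneg_entry P hp t x x]
  have hfin := geo_bound G d hd hd0 hc x w T hT1 hw0 hwx hle hen hnorm hloc
  have hM : w x ≤ 18 * Real.sqrt T := by
    refine abs_le_of_sq_le_sq' ?_ (by positivity) |>.2
    rw [mul_pow, Real.sq_sqrt (by linarith)]
    linarith
  rw [hsq]
  constructor
  · linarith
  · have : T * w x ≤ T * (18 * Real.sqrt T) := mul_le_mul_of_nonneg_left hM (by linarith)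
    linarith

/-- There is a universal constant `C > 0` such that for every finite
connected `d`-regular graph `G` on `n` vertices, every vertex `x`, every `K ≥ 1` and every
`t ≥ 2√6 t_rel^{3/4} √n`, the estimator `n̂_t = t² / ((1/K) ∑_k I_t^{(k)})` built from `K`
independent pairs of lazy random walks of length `t` started at `x` satisfies
`P_x(|n̂_t/n - 1| > 1/2) ≤ C/K`. -/
theorem vertex_estimator_regular_graphs : ∃ C : ℝ, 0 < C ∧
    ∀ (V : Type) [Fintype V] [Nontrivial V] (G : SimpleGraph V) (d : ℕ),
      G.Connected → G.IsRegularOfDegree d →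
      ∀ (x : V) (K t : ℕ), 1 ≤ K →
        2 * Real.sqrt 6 * (relTime (lazyP G) : ℝ) ^ ((3 : ℝ) / 4) *
            Real.sqrt (Fintype.card V : ℝ) ≤ (t : ℝ) →
          EK (lazyP G) x t K (fun X Y =>
              if 1 / 2 <
                  |(t : ℝ) ^ 2 / ((1 / (K : ℝ)) * ∑ k, nInter (X k) (Y k)) /
                      (Fintype.card V : ℝ) - 1|
              then 1 else 0) ≤ C / (K : ℝ) := by
  refine ⟨196, by norm_num, ?_⟩
  intro V _ _ G d hc hreg x K t hK ht
  have hd : ∀ u, G.degree u = d := fun u => by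
    have := hreg u
    convert this
  have hd0 : 0 < d := by
    obtain ⟨y, hy⟩ := exists_ne x
    rw [← hd x]
    exact hc.preconnected.degree_pos_of_nontrivial x
  set T : ℝ := (relTime (lazyP G) : ℝ) with hTdef
  set n : ℝ := (Fintype.card V : ℝ) with hndef
  have hT1 : 1 ≤ T := by rw [hTdef]; exact_mod_cast (poincare G d hd hd0 hc).1
  have hn : 0 < n := by
    rw [hndef]; exact_mod_cast Fintype.card_pos
  have hT34 : (T ^ ((3:ℝ)/4))^2 = T * Real.sqrt T := by
    have hT0 : 0 < T := by linarith
    rw [← Real.rpow_natCast, ← Real.rpow_mul hT0.le, Real.sqrt_eq_rpow]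
    nth_rewrite 2 [← Real.rpow_one T]
    rw [← Real.rpow_add hT0]
    norm_num
  have hlhs : 0 < 2 * Real.sqrt 6 * T ^ ((3:ℝ)/4) * Real.sqrt n := by
    have hT0 : 0 < T := by linarith
    positivity
  have htpos : (0:ℝ) < t := lt_of_lt_of_le hlhs ht
  have ht2 : 24 * (T * Real.sqrt T) * n ≤ (t:ℝ)^2 := by
    have h1 := pow_le_pow_left₀ hlhs.le ht 2
    have h2 : (2 * Real.sqrt 6 * T ^ ((3:ℝ)/4) * Real.sqrt n)^2 = 24 * (T * Real.sqrt T) * n := by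
      rw [mul_pow, mul_pow, mul_pow, hT34, Real.sq_sqrt hn.le, Real.sq_sqrt (by norm_num)]
      ring
    linarith
  have htn : 24 * (T * Real.sqrt T) ≤ (t:ℝ)^2 / n := by
    rw [le_div_iff₀ hn]; exact ht2
  have ht0 : 0 < t := by exact_mod_cast htpos
  obtain ⟨s, rfl⟩ : ∃ s, t = s + 1 := ⟨t - 1, by omega⟩
  set τ : ℝ := ((s + 1 : ℕ) : ℝ) with hτ
  set N : ℝ := τ^2 / n with hN
  have hNpos : 0 < N := by positivity
  have hs := lazy_sum G d hd hd0
  have hp := lazy_nonneg G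
  have hub : ∀ u, ∑ v, (green (lazyP G) (s+1) u v)^2 ≤ 7/4 * N := by
    intro u
    have := (green_bound G d hd hd0 hc u (s+1)).2
    linarith
  have hlb := (green_bound G d hd hd0 hc x (s+1)).1
  have hm := E2_nInter (lazyP G) hs x s
  have hB := E2_nInter_sq (lazyP G) hs hp x s _ hub
  have hKpos : (0:ℝ) < K := by exact_mod_cast hK
  refine le_trans (chebyshev_EK (lazyP G) hs hp x s K hK _ (N/4) _ (by linarith) hm hB _ ?_) ?_
  · intro X Y hbad
    set A := (1 / (K:ℝ)) * ∑ k, nInter (X k) (Y k) with hA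
    have hA0 : 0 ≤ A := by
      refine mul_nonneg (by positivity) (Finset.sum_nonneg fun k _ => ?_)
      exact Finset.sum_nonneg fun i _ => Finset.sum_nonneg fun j _ => by split_ifs <;> norm_num
    by_contra hcon
    push Not at hcon
    obtain ⟨h1, h2⟩ := abs_lt.1 hcon
    have h3 := hub x
    have h4 : 3/4 * N < A := by linarith
    have h5 : A < 2 * N := by linarith
    have hApos : 0 < A := by linarith
    have h6 : τ^2 / A / n = N / A := by rw [hN]; field_simp
    rw [h6] at hbad
    have h7 : N / A ≤ 3/2 := by rw [div_le_iff₀ hApos]; linarith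
    have h8 : 1/2 ≤ N / A := by rw [le_div_iff₀ hApos]; linarith
    have : |N / A - 1| ≤ 1/2 := abs_le.2 ⟨by linarith, by linarith⟩
    linarith
  · refine le_of_eq ?_
    field_simp
    norm_num
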